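/- In the Subbotin sparse sequence model with parameter ζ > 1, for any n and s_n with 1 ≤ s_n ≤ n, and any 𝐛 = (b_1,…,b_{s_n}) with b_j > −(ζ log(n/s_n))^{1/ζ}, the non-asymptotic classification minimax lower bound holds: inf_φ sup_{θ∈Θ_𝐛} E_θ[L_C(θ,φ)] ≥ 𝔉̄_n(𝐛,1) · s_n, where the infimum is over all multiple testing procedures. -/

import Mathlib

open MeasureTheory ProbabilityTheory Filter
open scoped Classical ENNReal

noncomputable section

/-- Unnormalized Subbotin density `e^{-|x|^ζ/ζ}`. -/
def sDensity (ζ : ℝ) (x : ℝ) : ℝ := Real.exp (-|x| ^ ζ / ζ)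

/-- Normalizing constant `L_ζ = ∫ e^{-|x|^ζ/ζ} dx`. -/
def Lz (ζ : ℝ) : ℝ := ∫ x : ℝ, sDensity ζ x

/-- Subbotin density `f(x) = L_ζ⁻¹ e^{-|x|^ζ/ζ}`. -/
def sf (ζ : ℝ) (x : ℝ) : ℝ := (Lz ζ)⁻¹ * sDensity ζ x

/-- Subbotin noise distribution: the measure with density `f` w.r.t. Lebesgue measure. -/
def noiseMeasure (ζ : ℝ) : Measure ℝ :=
  MeasureTheory.volume.withDensity fun x => ENNReal.ofReal (sf ζ x)

/-- Subbotin upper tail function `F̄(x) = ∫_x^∞ f(u) du`. -/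
def Fbar (ζ : ℝ) (x : ℝ) : ℝ := ∫ u in Set.Ioi x, sf ζ u

/-- Law of the observation `X = θ + ε` with `ε_i` i.i.d. Subbotin(ζ) noise. -/
def obsLaw {n : ℕ} (ζ : ℝ) (θ : Fin n → ℝ) : Measure (Fin n → ℝ) :=
  Measure.pi fun i =>
    MeasureTheory.volume.withDensity fun x => ENNReal.ofReal (sf ζ (x - θ i))

/-- Number of rejections of the decision vector `v`. -/
def numRej {n : ℕ} (v : Fin n → Bool) : ℕ :=
  (Finset.univ.filter fun i => v i = true).card

/-- Support of `θ`. -/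
def supp {n : ℕ} (θ : Fin n → ℝ) : Finset (Fin n) :=
  Finset.univ.filter fun i => θ i ≠ 0

/-- False discovery proportion. -/
def FDP {n : ℕ} (θ : Fin n → ℝ) (v : Fin n → Bool) : ℝ :=
  ((Finset.univ.filter fun i => θ i = 0 ∧ v i = true).card : ℝ) / max 1 (numRej v : ℝ)

/-- False negative proportion. -/
def FNP {n : ℕ} (θ : Fin n → ℝ) (v : Fin n → Bool) : ℝ :=
  ((Finset.univ.filter fun i => θ i ≠ 0 ∧ v i = false).card : ℝ) / max 1 ((supp θ).card : ℝ)

/-- False discovery rate. -/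
def FDR {n : ℕ} (ζ : ℝ) (θ : Fin n → ℝ) (φ : (Fin n → ℝ) → Fin n → Bool) : ℝ :=
  ∫ x, FDP θ (φ x) ∂(obsLaw ζ θ)

/-- False negative rate. -/
def FNR {n : ℕ} (ζ : ℝ) (θ : Fin n → ℝ) (φ : (Fin n → ℝ) → Fin n → Bool) : ℝ :=
  ∫ x, FNP θ (φ x) ∂(obsLaw ζ θ)

/-- Combined multiple testing risk `𝔎 = FDR + FNR`. -/
def mtRisk {n : ℕ} (ζ : ℝ) (θ : Fin n → ℝ) (φ : (Fin n → ℝ) → Fin n → Bool) : ℝ :=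
  FDR ζ θ φ + FNR ζ θ φ

/-- Oracle threshold `a* = (ζ log(n/s_n))^{1/ζ}`. -/
def astar (ζ : ℝ) (n s : ℕ) : ℝ := (ζ * Real.log ((n : ℝ) / (s : ℝ))) ^ (1 / ζ)

/-- The class `Θ_𝐛`: sparse vectors with `s` coordinates (at distinct positions) whose
absolute values are at least `a* + b_j`, `j = 1, …, s`. -/
def ThetaMult (ζ : ℝ) (n s : ℕ) (b : Fin s → ℝ) : Set (Fin n → ℝ) :=
  {θ | (supp θ).card ≤ s ∧
    ∃ ι : Fin s → Fin n, Function.Injective ι ∧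
      ∀ j, astar ζ n s + b j ≤ |θ (ι j)|}

/-- `Λ_n(𝐛) = s⁻¹ Σ_j F̄(b_j)`. -/
def Lambda (ζ : ℝ) (s : ℕ) (b : Fin s → ℝ) : ℝ := (∑ j, Fbar ζ (b j)) / (s : ℝ)

/-- `p_n(b,ρ) = P(#{2 ≤ i ≤ ⌊n/s⌋ : ε_i > a_b + ε_1} ≥ ρ)` for i.i.d. Subbotin noise,
realised on the product space `ℝ × (Fin (⌊n/s⌋ - 1) → ℝ)` where the first coordinate
plays the role of `ε_1`. -/
def pn (ζ : ℝ) (n s : ℕ) (b : ℝ) (ρ : ℕ) : ℝ :=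
  (((noiseMeasure ζ).prod (Measure.pi fun _ : Fin (n / s - 1) => noiseMeasure ζ))
    {p | ρ ≤ (Finset.univ.filter fun i => astar ζ n s + b + p.1 < p.2 i).card}).toReal

/-- `𝔉̄_n(𝐛,ρ) = s⁻¹ Σ_j p_n(b_j,ρ)`. -/
def Fcal (ζ : ℝ) (n s : ℕ) (b : Fin s → ℝ) (ρ : ℕ) : ℝ :=
  (∑ j, pn ζ n s (b j) ρ) / (s : ℝ)

/-- `ω_{δ,q} = exp(−(⌊q⌋−1) F̄((ζ log q)^{1/ζ} − δ))`. -/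
def omegaDQ (ζ δ q : ℝ) : ℝ :=
  Real.exp (-((⌊q⌋ : ℝ) - 1) * Fbar ζ ((ζ * Real.log q) ^ (1 / ζ) - δ))

/-- Classification (Hamming) loss. -/
def Lclass {n : ℕ} (θ : Fin n → ℝ) (v : Fin n → Bool) : ℕ :=
  (Finset.univ.filter fun i => θ i = 0 ∧ v i = true).card +
  (Finset.univ.filter fun i => θ i ≠ 0 ∧ v i = false).card

lemma Lz_pos {ζ : ℝ} (hζ : 0 < ζ) : 0 < Lz ζ := by
  have h : Lz ζ = 2 * ∫ x in Set.Ioi (0 : ℝ), Real.exp (-(ζ⁻¹) * x ^ ζ) := by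
    rw [← integral_comp_abs (f := fun x => Real.exp (-(ζ⁻¹) * x ^ ζ))]
    refine integral_congr_ae (ae_of_all _ fun x => ?_)
    simp only [sDensity]
    congr 1
    ring
  rw [h, integral_exp_neg_mul_rpow hζ (inv_pos.2 hζ)]
  have := Real.Gamma_pos_of_pos (show 0 < 1 / ζ + 1 by positivity)
  positivity

lemma sf_nonneg {ζ : ℝ} (hζ : 0 < ζ) (x : ℝ) : 0 ≤ sf ζ x :=
  mul_nonneg (inv_nonneg.2 (Lz_pos hζ).le) (Real.exp_pos _).le

lemma integrable_sf {ζ : ℝ} (hζ : 0 < ζ) : Integrable (sf ζ) :=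
  (Integrable.of_integral_ne_zero (Lz_pos hζ).ne').const_mul _

lemma integral_sf {ζ : ℝ} (hζ : 0 < ζ) : ∫ x, sf ζ x = 1 := by
  simp only [sf]
  rw [integral_const_mul]
  exact inv_mul_cancel₀ (Lz_pos hζ).ne'

@[fun_prop]
lemma measurable_sf (ζ : ℝ) : Measurable (sf ζ) := by
  unfold sf sDensity
  fun_prop

lemma isProbabilityMeasure_shifted {ζ : ℝ} (hζ : 0 < ζ) (t : ℝ) :
    IsProbabilityMeasure (volume.withDensity fun x => ENNReal.ofReal (sf ζ (x - t))) := by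
  constructor
  rw [withDensity_apply _ MeasurableSet.univ, Measure.restrict_univ,
    ← ofReal_integral_eq_lintegral_ofReal ((integrable_sf hζ).comp_sub_right t)
      (ae_of_all _ fun x => sf_nonneg hζ _), integral_sub_right_eq_self (sf ζ) t, integral_sf hζ,
    ENNReal.ofReal_one]

lemma isProbabilityMeasure_noiseMeasure {ζ : ℝ} (hζ : 0 < ζ) :
    IsProbabilityMeasure (noiseMeasure ζ) := by
  simpa [noiseMeasure] using isProbabilityMeasure_shifted hζ 0

lemma isProbabilityMeasure_obsLaw {n : ℕ} {ζ : ℝ} (hζ : 0 < ζ) (θ : Fin n → ℝ) :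
    IsProbabilityMeasure (obsLaw ζ θ) := by
  have := fun i => isProbabilityMeasure_shifted hζ (θ i)
  unfold obsLaw
  infer_instance

/-- The shifted noise law is the push-forward of the noise law under a translation. -/
lemma map_add_noiseMeasure (ζ t : ℝ) :
    (noiseMeasure ζ).map (fun x => x + t) =
      volume.withDensity fun x => ENNReal.ofReal (sf ζ (x - t)) := by
  ext A hA
  have hm : Measurable fun x : ℝ => x + t := by fun_prop
  rw [Measure.map_apply hm hA, noiseMeasure, withDensity_apply _ (hm hA), withDensity_apply _ hA,
    ← lintegral_indicator (hm hA), ← lintegral_indicator hA,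
    ← lintegral_add_right_eq_self (A.indicator _) t]
  refine lintegral_congr fun x => ?_
  simp [Set.indicator]

lemma map_add_pi_noiseMeasure {n : ℕ} {ζ : ℝ} (hζ : 0 < ζ) (θ : Fin n → ℝ) :
    (Measure.pi fun _ : Fin n => noiseMeasure ζ).map (fun x i => x i + θ i) = obsLaw ζ θ := by
  have := isProbabilityMeasure_noiseMeasure hζ
  rw [Measure.pi_map_pi (μ := fun _ : Fin n => noiseMeasure ζ) (f := fun i x => x + θ i)
    (fun i => by fun_prop)]
  simp only [map_add_noiseMeasure, obsLaw]

/-- A product of absolutely continuous finite measures has the product density. -/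
lemma pi_withDensity_ofReal {ι : Type*} [Fintype ι] {f : ι → ℝ → ℝ}
    (hf : ∀ i, Integrable (f i)) (h0 : ∀ i x, 0 ≤ f i x) :
    Measure.pi (fun i => volume.withDensity fun x => ENNReal.ofReal (f i x)) =
      (volume : Measure (ι → ℝ)).withDensity fun x => ∏ i, ENNReal.ofReal (f i (x i)) := by
  have := fun i => isFiniteMeasure_withDensity_ofReal (hf i).2
  refine Measure.pi_eq fun A hA => ?_
  rw [withDensity_apply _ (MeasurableSet.univ_pi hA), volume_pi, Measure.restrict_pi_pi]
  have hfA := fun i => (hf i).restrict (s := A i)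
  calc ∫⁻ x : ι → ℝ, ∏ i, ENNReal.ofReal (f i (x i)) ∂Measure.pi (fun i => volume.restrict (A i))
      = ∫⁻ x : ι → ℝ, ENNReal.ofReal (∏ i, f i (x i))
          ∂Measure.pi (fun i => volume.restrict (A i)) := by
        refine lintegral_congr fun x => ?_
        rw [ENNReal.ofReal_prod_of_nonneg fun i _ => h0 i _]
    _ = ENNReal.ofReal (∏ i, ∫ x in A i, f i x) := by
        rw [← ofReal_integral_eq_lintegral_ofReal (Integrable.fintype_prod hfA)
          (ae_of_all _ fun x => Finset.prod_nonneg fun i _ => h0 i _),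
          integral_fintype_prod_eq_prod]
    _ = _ := by
        rw [ENNReal.ofReal_prod_of_nonneg
          fun i _ => setIntegral_nonneg (hA i) fun x _ => h0 i x]
        refine Finset.prod_congr rfl fun i _ => ?_
        rw [withDensity_apply _ (hA i), ofReal_integral_eq_lintegral_ofReal (hfA i)
          (ae_of_all _ fun x => h0 i x)]

/-- Joint density of the observation with mean `θ`. -/
def obsDensity {n : ℕ} (ζ : ℝ) (θ x : Fin n → ℝ) : ℝ≥0∞ :=
  ∏ i, ENNReal.ofReal (sf ζ (x i - θ i))

@[fun_prop]
lemma measurable_obsDensity {n : ℕ} (ζ : ℝ) (θ : Fin n → ℝ) :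
    Measurable (obsDensity ζ θ) := by
  unfold obsDensity
  fun_prop

lemma obsLaw_eq_withDensity {n : ℕ} {ζ : ℝ} (hζ : 0 < ζ) (θ : Fin n → ℝ) :
    obsLaw ζ θ = volume.withDensity (obsDensity ζ θ) :=
  pi_withDensity_ofReal (f := fun i x => sf ζ (x - θ i))
    (fun i => (integrable_sf hζ).comp_sub_right (θ i)) fun _ _ => sf_nonneg hζ _

/-- A function `g` convex on `ℝ` has monotone increments over a fixed step `a > 0`. -/
lemma ConvexOn.add_le_add_of_step {g : ℝ → ℝ} (hg : ConvexOn ℝ Set.univ g) {a x y : ℝ}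
    (ha : 0 < a) (hxy : x ≤ y) : g x + g (y - a) ≤ g (x - a) + g y := by
  have hd : 0 < y - x + a := by linarith
  have h1 := hg.2 (Set.mem_univ (x - a)) (Set.mem_univ y)
    (show 0 ≤ (y - x) / (y - x + a) from div_nonneg (by linarith) hd.le)
    (show 0 ≤ a / (y - x + a) by positivity) (by field_simp)
  have h2 := hg.2 (Set.mem_univ (x - a)) (Set.mem_univ y)
    (show 0 ≤ a / (y - x + a) by positivity)
    (show 0 ≤ (y - x) / (y - x + a) from div_nonneg (by linarith) hd.le)
    (by field_simp; ring)
  simp only [smul_eq_mul] at h1 h2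
  have e1 : (y - x) / (y - x + a) * (x - a) + a / (y - x + a) * y = x := by
    field_simp; ring
  have e2 : a / (y - x + a) * (x - a) + (y - x) / (y - x + a) * y = y - a := by
    field_simp; ring
  rw [e1] at h1
  rw [e2] at h2
  have e3 : (y - x) / (y - x + a) + a / (y - x + a) = 1 := by field_simp
  have e4 : g (x - a) * ((y - x) / (y - x + a) + a / (y - x + a)) +
      g y * ((y - x) / (y - x + a) + a / (y - x + a)) = g (x - a) + g y := by
    rw [e3]; ring
  linarith

lemma convexOn_abs_rpow {p : ℝ} (hp : 1 ≤ p) : ConvexOn ℝ Set.univ fun x : ℝ => |x| ^ p := by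
  refine ⟨convex_univ, fun x _ y _ u v hu hv huv => ?_⟩
  refine le_trans ?_ ((convexOn_rpow hp).2 (abs_nonneg x) (abs_nonneg y) hu hv huv)
  refine Real.rpow_le_rpow (abs_nonneg _) ?_ (by linarith)
  refine (abs_add_le _ _).trans_eq ?_
  simp [abs_mul, abs_of_nonneg hu, abs_of_nonneg hv]

/-- Monotone likelihood ratio of the Subbotin location family. -/
lemma sf_mul_sf_le {ζ : ℝ} (hζ : 1 < ζ) {a x y : ℝ} (ha : 0 < a) (hxy : x ≤ y) :
    sf ζ (x - a) * sf ζ y ≤ sf ζ x * sf ζ (y - a) := by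
  have hL := inv_pos.2 (Lz_pos (zero_lt_one.trans hζ))
  have h := (convexOn_abs_rpow hζ.le).add_le_add_of_step ha hxy
  simp only [sf, sDensity]
  rw [mul_mul_mul_comm, mul_mul_mul_comm _ _ (Lz ζ)⁻¹, ← Real.exp_add, ← Real.exp_add]
  refine mul_le_mul_of_nonneg_left (Real.exp_le_exp.2 ?_) (by positivity)
  rw [← add_div, ← add_div]
  exact div_le_div_of_nonneg_right (by linarith) (by linarith)

/-- Mean vector with one signal per block: `e (j, k)` is the `k`-th position of the `j`-th block,
which carries its signal `a j` at position `k = c j`. -/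
def blockMean {n s q : ℕ} (e : Fin s × Fin q → Fin n) (a : Fin s → ℝ) (c : Fin s → Fin q) :
    Fin n → ℝ :=
  Function.extend e (fun p => if p.2 = c p.1 then a p.1 else 0) 0

section blockMean

variable {n s q : ℕ} {e : Fin s × Fin q → Fin n} {a : Fin s → ℝ}

lemma blockMean_apply (he : e.Injective) (c : Fin s → Fin q) (p : Fin s × Fin q) :
    blockMean e a c (e p) = if p.2 = c p.1 then a p.1 else 0 :=
  he.extend_apply _ _ _

lemma blockMean_ne_zero_iff (he : e.Injective) (ha : ∀ j, 0 < a j) (c : Fin s → Fin q)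
    (p : Fin s × Fin q) : blockMean e a c (e p) ≠ 0 ↔ p.2 = c p.1 := by
  rw [blockMean_apply he]
  simp [(ha p.1).ne']

lemma blockMean_mem {ζ : ℝ} {b : Fin s → ℝ} (he : e.Injective) (c : Fin s → Fin q) :
    blockMean e (fun j => astar ζ n s + b j) c ∈ ThetaMult ζ n s b := by
  have hinj : Function.Injective fun j => e (j, c j) := fun j j' h =>
    congrArg Prod.fst (he h)
  refine ⟨?_, fun j => e (j, c j), hinj, fun j => ?_⟩
  · have hsub : supp (blockMean e (fun j => astar ζ n s + b j) c) ⊆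
        Finset.univ.image fun j => e (j, c j) := by
      intro i hi
      simp only [supp, Finset.mem_filter, Finset.mem_univ, true_and] at hi
      by_cases h : ∃ p, e p = i
      · obtain ⟨⟨j, k⟩, rfl⟩ := h
        rw [blockMean_apply he] at hi
        have hk : k = c j := by
          by_contra hk
          exact hi (if_neg hk)
        exact Finset.mem_image.2 ⟨j, Finset.mem_univ _, by rw [hk]⟩
      · exact absurd (Function.extend_apply' _ _ _ h) hi
    exact (Finset.card_le_card hsub).trans (Finset.card_image_le.trans_eq (by simp))
  · rw [blockMean_apply he]
    simp [le_abs_self]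

/-- The Hamming loss is at least the number of blocks which are not classified exactly. -/
lemma sum_block_errors_le_Lclass (he : e.Injective) (ha : ∀ j, 0 < a j) (c : Fin s → Fin q)
    (v : Fin n → Bool) :
    ∑ j, (if ∀ k, v (e (j, k)) = true ↔ k = c j then (0 : ℝ≥0∞) else 1) ≤
      Lclass (blockMean e a c) v := by
  set B : Finset (Fin s) := Finset.univ.filter fun j => ¬ ∀ k, v (e (j, k)) = true ↔ k = c j
  have hsum : ∑ j, (if ∀ k, v (e (j, k)) = true ↔ k = c j then (0 : ℝ≥0∞) else 1) = B.card := by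
    rw [Finset.card_filter]
    push_cast
    exact Finset.sum_congr rfl fun j _ => by split_ifs <;> simp_all
  rw [hsum]
  have hB : ∀ j ∈ B, ∃ k, ¬ (v (e (j, k)) = true ↔ k = c j) := fun j hj => by
    simpa [B] using hj
  have : ∀ j, ∃ k, j ∈ B → ¬ (v (e (j, k)) = true ↔ k = c j) := fun j => by
    by_cases hj : j ∈ B
    · exact (hB j hj).imp fun _ h _ => h
    · exact ⟨c j, fun h => absurd h hj⟩
  choose w hw using this
  have hdis : Disjoint (Finset.univ.filter fun i => blockMean e a c i = 0 ∧ v i = true)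
      (Finset.univ.filter fun i => blockMean e a c i ≠ 0 ∧ v i = false) := by
    rw [Finset.disjoint_filter]
    intro i _ h1 h2
    exact h2.1 h1.1
  rw [Lclass, ← Finset.card_union_of_disjoint hdis]
  refine Nat.cast_le.2 (Finset.card_le_card_of_injOn (fun j => e (j, w j)) ?_ ?_)
  · intro j hj
    have h := hw j hj
    have h' := blockMean_ne_zero_iff he ha c (j, w j)
    simp only [Finset.coe_union, Finset.coe_filter, Finset.mem_univ, true_and, Set.mem_union,
      Set.mem_ofPred_eq]
    by_cases hk : w j = c j
    · right
      refine ⟨h'.2 hk, ?_⟩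
      simpa [hk] using h
    · left
      refine ⟨by_contra fun h0 => hk (h'.1 h0), ?_⟩
      simpa [hk] using h
  · intro j _ j' _ h
    exact congrArg Prod.fst (he h)

/-- Within a block, the likelihood of a signal position increases with the observed value. -/
lemma obsDensity_update_le {ζ : ℝ} (hζ : 1 < ζ) (he : e.Injective) (ha : ∀ j, 0 < a j)
    (c : Fin s → Fin q) (j : Fin s) {k l : Fin q} {x : Fin n → ℝ}
    (hx : x (e (j, k)) ≤ x (e (j, l))) :
    obsDensity ζ (blockMean e a (Function.update c j k)) x ≤
      obsDensity ζ (blockMean e a (Function.update c j l)) x := by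
  rcases eq_or_ne k l with rfl | hkl
  · exact le_rfl
  have hne : e (j, k) ≠ e (j, l) := fun h => hkl (congrArg Prod.snd (he h))
  unfold obsDensity
  rw [← Finset.prod_mul_prod_compl {e (j, k), e (j, l)},
    ← Finset.prod_mul_prod_compl {e (j, k), e (j, l)}
      fun i => ENNReal.ofReal (sf ζ (x i - blockMean e a (Function.update c j l) i)),
    Finset.prod_pair hne, Finset.prod_pair hne]
  refine mul_le_mul' ?_ (Finset.prod_le_prod' fun i hi => ?_)
  · have h0 := sf_nonneg (zero_lt_one.trans hζ)
    rw [← ENNReal.ofReal_mul (h0 _), ← ENNReal.ofReal_mul (h0 _)]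
    refine ENNReal.ofReal_le_ofReal ?_
    simpa [blockMean_apply he, hkl, hkl.symm] using sf_mul_sf_le hζ (ha j) hx
  · simp only [Finset.mem_compl, Finset.mem_insert, Finset.mem_singleton, not_or] at hi
    refine le_of_eq ?_
    congr 3
    by_cases h : ∃ p, e p = i
    · obtain ⟨⟨j', k'⟩, rfl⟩ := h
      rw [blockMean_apply he, blockMean_apply he]
      rcases eq_or_ne j' j with rfl | hj
      · have h1 : k' ≠ k := fun h => hi.1 (by rw [h])
        have h2 : k' ≠ l := fun h => hi.2 (by rw [h])
        simp [h1, h2]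
      · simp [hj]
    · rw [blockMean, blockMean, Function.extend_apply' _ _ _ h, Function.extend_apply' _ _ _ h]

end blockMean

/-- Guessing the position of a maximum of `y` is optimal when the weights `g` are increasing
in `y`: any exact guess, given by `C`, errs with at least as much weight. -/
lemma sum_not_max_le_sum_error {κ : Type*} [Fintype κ] {g : κ → ℝ≥0∞} {y : κ → ℝ}
    (hg : ∀ k l, y k ≤ y l → g k ≤ g l) {C : κ → Prop}
    (hC : ∀ k l, C k → C l → k = l) :
    ∑ k, g k * (if ∃ l, y k < y l then 1 else 0) ≤ ∑ k, g k * (if C k then 0 else 1) := by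
  by_cases hex : ∃ k₀, C k₀
  · obtain ⟨k₀, hk₀⟩ := hex
    have : Nonempty κ := ⟨k₀⟩
    obtain ⟨m, hm⟩ := Finite.exists_max y
    have hleft : ∑ k, g k * (if ∃ l, y k < y l then 1 else 0) ≤
        ∑ k ∈ Finset.univ.erase m, g k := by
      rw [← Finset.add_sum_erase _ _ (Finset.mem_univ m), if_neg (by simpa using hm), mul_zero,
        zero_add]
      exact Finset.sum_le_sum fun k _ => by split_ifs <;> simp
    have hright : ∑ k ∈ Finset.univ.erase k₀, g k ≤ ∑ k, g k * (if C k then 0 else 1) := by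
      rw [← Finset.add_sum_erase (Finset.univ) (fun k => g k * (if C k then 0 else 1))
        (Finset.mem_univ k₀), if_pos hk₀, mul_zero, zero_add]
      refine Finset.sum_le_sum fun k hk => ?_
      rw [if_neg fun h => Finset.ne_of_mem_erase hk (hC _ _ h hk₀), mul_one]
    refine hleft.trans (le_trans ?_ hright)
    rcases eq_or_ne m k₀ with rfl | hne
    · exact le_rfl
    · rw [← Finset.add_sum_erase _ _ (Finset.mem_erase.2 ⟨hne.symm, Finset.mem_univ k₀⟩),
        ← Finset.add_sum_erase (Finset.univ.erase k₀) _
          (Finset.mem_erase.2 ⟨hne, Finset.mem_univ m⟩), Finset.erase_right_comm]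
      exact add_le_add_left (hg _ _ (hm k₀)) _
  · push Not at hex
    refine Finset.sum_le_sum fun k _ => ?_
    rw [if_neg (hex k)]
    split_ifs <;> simp

/-- Sums over functions may be compared one coordinate at a time. -/
lemma sum_pi_le_sum_pi_of_update {s q : ℕ} (j : Fin s) {u v : (Fin s → Fin q) → ℝ≥0∞}
    (h : ∀ c, ∑ k, u (Function.update c j k) ≤ ∑ k, v (Function.update c j k)) :
    ∑ c, u c ≤ ∑ c, v c := by
  have key : ∀ w : (Fin s → Fin q) → ℝ≥0∞, ∑ c, w c =
      ∑ r : ({i // i ≠ j} → Fin q), ∑ k : Fin q,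
        w ((Equiv.piSplitAt j fun _ : Fin s => Fin q).symm (k, r)) := fun w => by
    rw [← (Equiv.piSplitAt j fun _ : Fin s => Fin q).symm.sum_comp, Fintype.sum_prod_type_right]
  rw [key u, key v]
  refine Finset.sum_le_sum fun r _ => ?_
  rcases isEmpty_or_nonempty (Fin q) with hq | ⟨⟨k₀⟩⟩
  · simp
  have hupd : ∀ k, (Equiv.piSplitAt j fun _ : Fin s => Fin q).symm (k, r) =
      Function.update ((Equiv.piSplitAt j fun _ : Fin s => Fin q).symm (k₀, r)) j k := by
    intro k
    funext i
    rcases eq_or_ne i j with rfl | hij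
    · simp [Equiv.piSplitAt]
    · simp [Equiv.piSplitAt, hij]
  simpa only [← hupd] using h ((Equiv.piSplitAt j fun _ : Fin s => Fin q).symm (k₀, r))

/-- Selecting distinct coordinates of an i.i.d. sample yields an i.i.d. sample. -/
lemma map_comp_injective_pi {ι κ : Type*} [Fintype ι] [Fintype κ] {μ : Measure ℝ}
    [IsProbabilityMeasure μ] {e : κ → ι} (he : e.Injective) :
    (Measure.pi fun _ : ι => μ).map (fun x k => x (e k)) = Measure.pi fun _ : κ => μ := by
  have h : iIndepFun (fun (i : ι) (x : ι → ℝ) => x i) (Measure.pi fun _ : ι => μ) :=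
    iIndepFun_pi (X := fun _ x => x) fun _ => aemeasurable_id
  have h' := h.precomp he
  rw [iIndepFun_iff_map_fun_eq_pi_map fun k => (measurable_pi_apply _).aemeasurable] at h'
  refine h'.trans ?_
  congr 1
  ext1 k
  exact (measurePreserving_eval (fun _ : ι => μ) (e k)).map_eq

/-- The probability defining `pn ζ n s β 1`, with all the noise variables on the same footing. -/
lemma pi_exceed_eq {μ : Measure ℝ} [IsProbabilityMeasure μ] {q : ℕ} (t : ℝ) (k : Fin (q + 1)) :
    (Measure.pi fun _ : Fin (q + 1) => μ) {y | ∃ l, l ≠ k ∧ t + y k < y l} =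
      (μ.prod (Measure.pi fun _ : Fin q => μ))
        {p | 1 ≤ (Finset.univ.filter fun i => t + p.1 < p.2 i).card} := by
  have hmp := measurePreserving_piFinSuccAbove (fun _ : Fin (q + 1) => μ) k
  rw [← hmp.measure_preimage_equiv]
  congr 1
  ext y
  simp only [Set.mem_ofPred_eq, Set.mem_preimage, Finset.one_le_card, Finset.Nonempty,
    Finset.mem_filter, Finset.mem_univ, true_and]
  constructor
  · rintro ⟨l, hl, h⟩
    obtain ⟨i, rfl⟩ := Fin.exists_succAbove_eq hl
    exact ⟨i, h⟩
  · rintro ⟨i, h⟩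
    exact ⟨k.succAbove i, Fin.succAbove_ne k i, h⟩

/-- Under a block mean, the probability that the signal of block `j` is not the largest
observation of its block. -/
lemma obsLaw_not_max {n s q : ℕ} {ζ : ℝ} (hζ : 0 < ζ) {e : Fin s × Fin (q + 1) → Fin n}
    (he : e.Injective) {a : Fin s → ℝ} (c : Fin s → Fin (q + 1)) (j : Fin s) :
    obsLaw ζ (blockMean e a c) {x | ∃ l, x (e (j, c j)) < x (e (j, l))} =
      ((noiseMeasure ζ).prod (Measure.pi fun _ : Fin q => noiseMeasure ζ))
        {p | 1 ≤ (Finset.univ.filter fun i => a j + p.1 < p.2 i).card} := by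
  have := isProbabilityMeasure_noiseMeasure hζ
  have hinj : Function.Injective fun k => e (j, k) := fun k l h => congrArg Prod.snd (he h)
  have hA : MeasurableSet {x : Fin n → ℝ | ∃ l, x (e (j, c j)) < x (e (j, l))} := by
    simp only [Set.ofPred_exists]
    exact MeasurableSet.iUnion fun l => measurableSet_lt (by fun_prop) (by fun_prop)
  have hB : MeasurableSet {y : Fin (q + 1) → ℝ | ∃ l, l ≠ c j ∧ a j + y (c j) < y l} := by
    simp only [Set.ofPred_exists]
    exact MeasurableSet.iUnion fun l =>
      (MeasurableSet.const (l ≠ c j)).inter (measurableSet_lt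
        (f := fun y : Fin (q + 1) → ℝ => a j + y (c j)) (g := fun y => y l)
        (by fun_prop) (by fun_prop))
  rw [← pi_exceed_eq (a j) (c j), ← map_comp_injective_pi (μ := noiseMeasure ζ) hinj,
    Measure.map_apply (by fun_prop) hB, ← map_add_pi_noiseMeasure hζ,
    Measure.map_apply (by fun_prop) hA]
  congr 1
  ext x
  simp only [Set.mem_preimage, Set.mem_ofPred_eq, blockMean_apply he, if_true]
  refine exists_congr fun l => ?_
  by_cases hl : l = c j
  · simp [hl]
  · simp [hl, add_comm]

/-- The average over block means of the expected Hamming loss is at least the expected number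
of blocks whose signal is not their largest observation. -/
lemma sum_obsLaw_not_max_le {n s q : ℕ} {ζ : ℝ} (hζ : 1 < ζ) {e : Fin s × Fin q → Fin n}
    (he : e.Injective) {a : Fin s → ℝ} (ha : ∀ j, 0 < a j) {φ : (Fin n → ℝ) → Fin n → Bool}
    (hφ : Measurable φ) :
    ∑ c : Fin s → Fin q, ∑ j,
        obsLaw ζ (blockMean e a c) {x | ∃ l, x (e (j, c j)) < x (e (j, l))} ≤
      ∑ c : Fin s → Fin q, ∫⁻ x, Lclass (blockMean e a c) (φ x) ∂obsLaw ζ (blockMean e a c) := by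
  have hζ0 := zero_lt_one.trans hζ
  have hA : ∀ (c : Fin s → Fin q) j,
      MeasurableSet {x : Fin n → ℝ | ∃ l, x (e (j, c j)) < x (e (j, l))} := by
    intro c j
    simp only [Set.ofPred_exists]
    exact MeasurableSet.iUnion fun l => measurableSet_lt (by fun_prop) (by fun_prop)
  have hleft : ∀ (c : Fin s → Fin q) j,
      obsLaw ζ (blockMean e a c) {x | ∃ l, x (e (j, c j)) < x (e (j, l))} =
        ∫⁻ x, obsDensity ζ (blockMean e a c) x *
          (if ∃ l, x (e (j, c j)) < x (e (j, l)) then 1 else 0) := by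
    intro c j
    rw [obsLaw_eq_withDensity hζ0, withDensity_apply _ (hA c j), ← lintegral_indicator (hA c j)]
    refine lintegral_congr fun x => ?_
    simp [Set.indicator]
  have hL : ∀ c : Fin s → Fin q,
      Measurable fun x => (Lclass (blockMean e a c) (φ x) : ℝ≥0∞) := fun c =>
    (Measurable.of_discrete (f := fun v => (Lclass (blockMean e a c) v : ℝ≥0∞))).comp hφ
  have hright : ∀ c : Fin s → Fin q,
      ∫⁻ x, Lclass (blockMean e a c) (φ x) ∂obsLaw ζ (blockMean e a c) =
        ∫⁻ x, obsDensity ζ (blockMean e a c) x * Lclass (blockMean e a c) (φ x) := fun c => by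
    rw [obsLaw_eq_withDensity hζ0,
      lintegral_withDensity_eq_lintegral_mul _ (measurable_obsDensity _ _) (hL c)]
    rfl
  have hind : ∀ (c : Fin s → Fin q) j, Measurable fun x : Fin n → ℝ =>
      obsDensity ζ (blockMean e a c) x *
        (if ∃ l, x (e (j, c j)) < x (e (j, l)) then (1 : ℝ≥0∞) else 0) := fun c j =>
    (measurable_obsDensity _ _).mul (Measurable.ite (hA c j) measurable_const measurable_const)
  simp_rw [hleft, hright]
  have hmul : ∀ c : Fin s → Fin q, Measurable fun x =>
      obsDensity ζ (blockMean e a c) x * Lclass (blockMean e a c) (φ x) := fun c =>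
    (measurable_obsDensity _ _).mul (hL c)
  rw [← lintegral_finsetSum _ fun c _ => hmul c]
  simp_rw [← lintegral_finsetSum _ fun j _ => hind _ j]
  rw [← lintegral_finsetSum _ fun c _ => Finset.measurable_fun_sum _ fun j _ => hind c j]
  refine lintegral_mono fun x => ?_
  calc ∑ c : Fin s → Fin q, ∑ j, obsDensity ζ (blockMean e a c) x *
          (if ∃ l, x (e (j, c j)) < x (e (j, l)) then (1 : ℝ≥0∞) else 0)
      ≤ ∑ c : Fin s → Fin q, ∑ j, obsDensity ζ (blockMean e a c) x *
          (if ∀ k, φ x (e (j, k)) = true ↔ k = c j then (0 : ℝ≥0∞) else 1) := by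
        rw [Finset.sum_comm, Finset.sum_comm (s := (Finset.univ : Finset (Fin s → Fin q)))]
        refine Finset.sum_le_sum fun j _ => sum_pi_le_sum_pi_of_update j fun c => ?_
        simp only [Function.update_self]
        convert sum_not_max_le_sum_error (y := fun k => x (e (j, k)))
          (g := fun k => obsDensity ζ (blockMean e a (Function.update c j k)) x)
          (C := fun k => ∀ l, φ x (e (j, l)) = true ↔ l = k)
          (fun k l h => obsDensity_update_le hζ he ha c j h)
          fun k l hk hl => (hl k).1 ((hk k).2 rfl)
    _ ≤ _ := by
        refine Finset.sum_le_sum fun c _ => ?_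
        rw [← Finset.mul_sum]
        gcongr
        exact sum_block_errors_le_Lclass he ha c (φ x)

lemma Lclass_le {n : ℕ} (θ : Fin n → ℝ) (v : Fin n → Bool) : Lclass θ v ≤ n := by
  rw [Lclass, ← Finset.card_union_of_disjoint]
  · exact (Finset.card_le_univ _).trans_eq (Fintype.card_fin n)
  · rw [Finset.disjoint_filter]
    intro i _ h1 h2
    exact h2.1 h1.1

lemma integrable_Lclass {n : ℕ} {ζ : ℝ} (hζ : 0 < ζ) (θ : Fin n → ℝ)
    {φ : (Fin n → ℝ) → Fin n → Bool} (hφ : Measurable φ) :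
    Integrable (fun x => (Lclass θ (φ x) : ℝ)) (obsLaw ζ θ) := by
  have := isProbabilityMeasure_obsLaw hζ θ
  refine Integrable.of_bound (C := n) ?_ (ae_of_all _ fun x => ?_)
  · exact ((Measurable.of_discrete (f := fun v => (Lclass θ v : ℝ))).comp hφ).aestronglyMeasurable
  · simpa using Lclass_le θ (φ x)

/-- Every risk over the parameter class is bounded by the iterated supremum. -/
lemma integral_Lclass_le_iSup {n : ℕ} {ζ : ℝ} (hζ : 0 < ζ) {T : Set (Fin n → ℝ)}
    {φ : (Fin n → ℝ) → Fin n → Bool} (hφ : Measurable φ) {θ : Fin n → ℝ} (hθ : θ ∈ T) :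
    ∫ x, (Lclass θ (φ x) : ℝ) ∂obsLaw ζ θ ≤
      ⨆ θ ∈ T, ∫ x, (Lclass θ (φ x) : ℝ) ∂obsLaw ζ θ := by
  have hle : ∀ θ, ∫ x, (Lclass θ (φ x) : ℝ) ∂obsLaw ζ θ ≤ n := fun θ => by
    have := isProbabilityMeasure_obsLaw hζ θ
    refine (integral_mono (integrable_Lclass hζ θ hφ) (integrable_const (n : ℝ))
      fun x => Nat.cast_le.2 (Lclass_le θ (φ x))).trans_eq ?_
    simp
  have hbdd : BddAbove (Set.range fun θ => ⨆ _ : θ ∈ T, ∫ x, (Lclass θ (φ x) : ℝ) ∂obsLaw ζ θ) := by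
    refine ⟨n, ?_⟩
    rintro _ ⟨θ, rfl⟩
    exact Real.iSup_le (fun _ => hle θ) (Nat.cast_nonneg n)
  refine le_trans ?_ (le_ciSup hbdd θ)
  rw [ciSup_pos hθ]

theorem statement_10 (ζ : ℝ) (hζ : 1 < ζ) (n s : ℕ)
    (hs : 1 ≤ s) (hsn : s ≤ n)
    (b : Fin s → ℝ) (hb : ∀ j, -(astar ζ n s) < b j)
    (φ : (Fin n → ℝ) → (Fin n → Bool)) (hφ : Measurable φ) :
    Fcal ζ n s b 1 * (s : ℝ) ≤
      ⨆ θ ∈ ThetaMult ζ n s b, ∫ x, (Lclass θ (φ x) : ℝ) ∂(obsLaw ζ θ) := by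
  have hζ0 := zero_lt_one.trans hζ
  have hnoise := isProbabilityMeasure_noiseMeasure hζ0
  set R := ⨆ θ ∈ ThetaMult ζ n s b, ∫ x, (Lclass θ (φ x) : ℝ) ∂(obsLaw ζ θ)
  obtain ⟨q, hq⟩ : ∃ q, q = n / s - 1 := ⟨_, rfl⟩
  have hsq : s * (q + 1) ≤ n := by
    rw [hq, Nat.sub_add_cancel (Nat.div_pos hsn hs)]
    exact Nat.mul_div_le n s
  let e : Fin s × Fin (q + 1) → Fin n := fun p => Fin.castLE hsq (finProdFinEquiv p)
  have he : e.Injective := (Fin.castLE_injective hsq).comp finProdFinEquiv.injective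
  let a : Fin s → ℝ := fun j => astar ζ n s + b j
  have ha : ∀ j, 0 < a j := fun j => by simpa [a] using neg_lt_iff_pos_add'.1 (hb j)
  let P : Fin s → ℝ≥0∞ := fun j =>
    ((noiseMeasure ζ).prod (Measure.pi fun _ : Fin q => noiseMeasure ζ))
      {p | 1 ≤ (Finset.univ.filter fun i => a j + p.1 < p.2 i).card}
  have hrisk : ∀ c : Fin s → Fin (q + 1),
      ∫⁻ x, Lclass (blockMean e a c) (φ x) ∂obsLaw ζ (blockMean e a c) ≤ ENNReal.ofReal R := by
    intro c
    refine le_trans (le_of_eq ?_)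
      (ENNReal.ofReal_le_ofReal (integral_Lclass_le_iSup hζ0 hφ (blockMean_mem he c)))
    rw [ofReal_integral_eq_lintegral_ofReal (integrable_Lclass hζ0 _ hφ)
      (ae_of_all _ fun x => Nat.cast_nonneg _)]
    simp [a]
  have hmain := (sum_obsLaw_not_max_le hζ he ha hφ).trans (Finset.sum_le_sum fun c _ => hrisk c)
  simp_rw [obsLaw_not_max hζ0 he] at hmain
  rw [Finset.sum_const, Finset.sum_const, nsmul_eq_mul, nsmul_eq_mul,
    ENNReal.mul_le_mul_iff_right (by simp) (by simp)] at hmain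
  have hR : 0 ≤ R := Real.iSup_nonneg fun θ => Real.iSup_nonneg fun _ =>
    integral_nonneg fun x => Nat.cast_nonneg _
  have hpn : ∀ j, pn ζ n s (b j) 1 = (P j).toReal := fun j => by
    subst hq
    rfl
  rw [Fcal, div_mul_cancel₀ _ (by positivity)]
  simp_rw [hpn]
  rw [← ENNReal.toReal_sum fun j _ => measure_ne_top _ _]
  exact ENNReal.toReal_le_of_le_ofReal hR hmain
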